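/- Let h: ℝ^n → ℝ be continuous, η > 0. Then the spherically smoothed function h_η(x) := E_{u∈𝔹}[h(x + η u)] is continuously differentiable, and its gradient satisfies ∇h_η(x) = (n/η) · E_{v ∈ η𝕊}[h(x + v) · v/‖v‖], where v is uniformly distributed on the sphere of radius η. -/

import Mathlib

open MeasureTheory Metric Set Pointwise Filter

noncomputable def ballUniform (n : ℕ) : Measure (EuclideanSpace ℝ (Fin n)) :=
  (volume (closedBall (0 : EuclideanSpace ℝ (Fin n)) 1))⁻¹ • volume.restrict (closedBall 0 1)

/-- Spherical smoothing: `h_η(x) = E_{u ∈ 𝔹}[h(x + η u)]` with `u` uniform on the unit ball. -/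
noncomputable def smoothed (n : ℕ) (η : ℝ) (h : EuclideanSpace ℝ (Fin n) → ℝ)
    (x : EuclideanSpace ℝ (Fin n)) : ℝ :=
  ∫ u, h (x + η • u) ∂(ballUniform n)


/-- Uniform distribution on the sphere of radius `η`: pushforward of the uniform ball
distribution under radial projection `u ↦ (η/‖u‖) • u`. -/
noncomputable def sphereUniform (n : ℕ) (η : ℝ) : Measure (EuclideanSpace ℝ (Fin n)) :=
  Measure.map (fun u => (η / ‖u‖) • u) (ballUniform n)

open scoped Topology Convolution

section Cutoff

theorem deriv_smoothTransition_of_nonpos {x : ℝ} (hx : x ≤ 0) :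
    deriv Real.smoothTransition x = 0 :=
  IsLocalMin.deriv_eq_zero <| Eventually.of_forall fun y => by
    rw [Real.smoothTransition.zero_of_nonpos hx]
    exact Real.smoothTransition.nonneg y

theorem deriv_smoothTransition_of_one_le {x : ℝ} (hx : 1 ≤ x) :
    deriv Real.smoothTransition x = 0 :=
  IsLocalMax.deriv_eq_zero <| Eventually.of_forall fun y => by
    rw [Real.smoothTransition.one_of_one_le hx]
    exact Real.smoothTransition.le_one y

theorem continuous_deriv_smoothTransition : Continuous (deriv Real.smoothTransition) :=
  (Real.smoothTransition.contDiff (n := 1)).continuous_deriv le_rfl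

theorem integral_deriv_smoothTransition :
    ∫ s in (0 : ℝ)..1, deriv Real.smoothTransition s = 1 := by
  rw [intervalIntegral.integral_deriv_eq_sub
    (fun x _ => (Real.smoothTransition.contDiffAt (n := 1)).differentiableAt one_ne_zero)
    (continuous_deriv_smoothTransition.intervalIntegrable _ _)]
  simp

/-- Integration against a profile rescaled to the layer `[1, 1 + ε]` and vanishing beyond it. -/
theorem integral_Ioi_profile_smul {F : Type*} [NormedAddCommGroup F] [NormedSpace ℝ F]
    {c : ℝ → ℝ} (hc : Continuous c) (hc0 : ∀ s ≤ 0, c s = 0) {a : ℝ → F} (ha : Continuous a)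
    {ε : ℝ} (hε : 0 < ε) :
    ∫ r in Ioi (0 : ℝ), c (1 + (1 - r) / ε) • a r =
      (∫ r in (0 : ℝ)..1, c (1 + (1 - r) / ε) • a r) +
        ε • ∫ s in (0 : ℝ)..1, c s • a (1 + ε * (1 - s)) := by
  have hcont : Continuous fun r => c (1 + (1 - r) / ε) • a r := by fun_prop
  have hsub : ∫ r in (1 : ℝ)..(1 + ε), c (1 + (1 - r) / ε) • a r =
      ε • ∫ s in (0 : ℝ)..1, c s • a (1 + ε * (1 - s)) := by
    have := intervalIntegral.smul_integral_comp_sub_mul (a := 0) (b := 1)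
      (fun r => c (1 + (1 - r) / ε) • a r) ε (1 + ε)
    simp only [mul_one, mul_zero, sub_zero, add_sub_cancel_right] at this
    rw [← this]
    congr 1
    refine intervalIntegral.integral_congr fun s _ => ?_
    have h1 : 1 + (1 - (1 + ε - ε * s)) / ε = s := by field_simp; ring
    have h2 : 1 + ε - ε * s = 1 + ε * (1 - s) := by ring
    simp only [h1]
    rw [h2]
  rw [← hsub, intervalIntegral.integral_add_adjacent_intervals
    (hcont.intervalIntegrable _ _) (hcont.intervalIntegrable _ _),
    intervalIntegral.integral_of_le (by linarith)]
  refine (setIntegral_eq_of_subset_of_forall_sdiff_eq_zero measurableSet_Ioi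
    (fun r hr => hr.1) fun r hr => ?_)
  have hr1 : 1 + ε < r := by
    by_contra! hle
    exact hr.2 ⟨hr.1, hle⟩
  rw [hc0, zero_smul]
  have : (1 - r) / ε ≤ -1 := by rw [div_le_iff₀ hε]; linarith
  linarith

end Cutoff

section Polar

variable {E F : Type*} [NormedAddCommGroup E] [InnerProductSpace ℝ E] [FiniteDimensional ℝ E]
  [MeasurableSpace E] [BorelSpace E]
  [NormedAddCommGroup F] [NormedSpace ℝ F]

theorem continuous_integral_sphere (μ : Measure E) [μ.IsAddHaarMeasure]
    {X : Type*} [TopologicalSpace X] [FirstCountableTopology X] [LocallyCompactSpace X]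
    {f : X → sphere (0 : E) 1 → F} (hf : Continuous f.uncurry) :
    Continuous fun x => ∫ θ, f x θ ∂μ.toSphere := by
  simpa using continuous_parametric_integral_of_continuous (μ := μ.toSphere) hf isCompact_univ

variable [Nontrivial E]

/-- Integration in polar coordinates. -/
theorem integral_eq_integral_Ioi_integral_sphere (μ : Measure E) [μ.IsAddHaarMeasure]
    {f : E → F} (hf : Integrable f μ) :
    ∫ t, f t ∂μ = ∫ r in Ioi (0 : ℝ),
      r ^ (Module.finrank ℝ E - 1) • ∫ θ, f (r • (θ : E)) ∂μ.toSphere := by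
  have hmp := μ.measurePreserving_homeomorphUnitSphereProd
  have hemb := (homeomorphUnitSphereProd E).measurableEmbedding
  let G : sphere (0 : E) 1 × Ioi (0 : ℝ) → F := fun p => f (p.2.1 • p.1.1)
  have hG : ∀ t : ({0}ᶜ : Set E), G (homeomorphUnitSphereProd E t) = f t := by
    intro t
    have ht : ‖(t : E)‖ ≠ 0 := norm_ne_zero_iff.2 t.2
    simp [G, smul_smul, ht]
  have hGint : Integrable G (μ.toSphere.prod (.volumeIoiPow (Module.finrank ℝ E - 1))) := by
    rw [← hmp.integrable_comp_emb hemb]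
    have : (G ∘ homeomorphUnitSphereProd E) = f ∘ Subtype.val := funext hG
    rw [this, ← integrableOn_iff_comap_subtypeVal (measurableSet_singleton _).compl]
    exact hf.integrableOn
  calc
    ∫ t, f t ∂μ = ∫ t : ({0}ᶜ : Set E), f t ∂(μ.comap (↑)) := by
      rw [integral_subtype_comap (measurableSet_singleton _).compl f, restrict_compl_singleton]
    _ = ∫ p, G p ∂μ.toSphere.prod (.volumeIoiPow (Module.finrank ℝ E - 1)) := by
      rw [← hmp.integral_comp hemb]
      simp_rw [hG]
    _ = ∫ r : Ioi (0 : ℝ), ∫ θ, G (θ, r) ∂μ.toSphere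
          ∂.volumeIoiPow (Module.finrank ℝ E - 1) := integral_prod_symm G hGint
    _ = _ := by
      simp only [Measure.volumeIoiPow, ENNReal.ofReal, G]
      rw [integral_withDensity_eq_integral_smul,
        integral_subtype_comap measurableSet_Ioi fun a : ℝ ↦
          Real.toNNReal (a ^ (Module.finrank ℝ E - 1)) • ∫ θ, f (a • (θ : E)) ∂μ.toSphere,
        setIntegral_congr_fun measurableSet_Ioi fun x hx ↦ ?_]
      · simp only [NNReal.smul_def, Real.coe_toNNReal _ (pow_nonneg (le_of_lt hx) _)]
      · exact (measurable_subtype_coe.pow_const _).real_toNNReal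

theorem setIntegral_closedBall_eq_integral_sphere (μ : Measure E) [μ.IsAddHaarMeasure]
    {f : E → F} (hf : IntegrableOn f (closedBall 0 1) μ) :
    ∫ t in closedBall 0 1, f t ∂μ = ∫ r in (0 : ℝ)..1,
      r ^ (Module.finrank ℝ E - 1) • ∫ θ, f (r • (θ : E)) ∂μ.toSphere := by
  rw [← integral_indicator measurableSet_closedBall, integral_eq_integral_Ioi_integral_sphere μ
    (hf.integrable_indicator measurableSet_closedBall),
    intervalIntegral.integral_of_le zero_le_one]
  refine (setIntegral_eq_of_subset_of_forall_sdiff_eq_zero measurableSet_Ioi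
    (s := Ioc 0 1) (fun r hr => hr.1) ?_).trans ?_
  rotate_left
  · refine setIntegral_congr_fun measurableSet_Ioc fun r hr => ?_
    have : ∀ θ : sphere (0 : E) 1, r • (θ : E) ∈ closedBall (0 : E) 1 := fun θ => by
      simp [norm_smul, abs_of_pos hr.1, hr.2]
    simp [indicator_of_mem (this _)]
  · intro r hr
    have hr1 : 1 < r := by
      by_contra! hle
      exact hr.2 ⟨hr.1, hle⟩
    have : ∀ θ : sphere (0 : E) 1, r • (θ : E) ∉ closedBall (0 : E) 1 := fun θ => by
      simp [norm_smul, abs_of_pos (zero_lt_one.trans hr1), hr1]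
    simp only [indicator_of_notMem (this _), integral_zero, smul_zero]

/-- The integral of a degree-zero homogeneous function over the unit ball. -/
theorem setIntegral_closedBall_inv_norm_smul [CompleteSpace F] (μ : Measure E) [μ.IsAddHaarMeasure]
    {f : E → F} (hf : Continuous f) :
    ∫ t in closedBall 0 1, f (‖t‖⁻¹ • t) ∂μ =
      (Module.finrank ℝ E : ℝ)⁻¹ • ∫ θ, f (θ : E) ∂μ.toSphere := by
  have hle : ∀ t : E, ‖‖t‖⁻¹ • t‖ ≤ 1 := fun t => by
    rw [norm_smul, norm_inv, norm_norm]
    exact inv_mul_le_one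
  have hInt : IntegrableOn (fun t => f (‖t‖⁻¹ • t)) (closedBall 0 1) μ := by
    obtain ⟨C, hC⟩ := (isCompact_closedBall (0 : E) 1).exists_bound_of_continuousOn hf.continuousOn
    refine IntegrableOn.of_bound measure_closedBall_lt_top ?_ C
      (.of_forall fun t => hC _ (by simpa using hle t))
    exact (hf.stronglyMeasurable.comp_measurable (by fun_prop)).aestronglyMeasurable
  rw [setIntegral_closedBall_eq_integral_sphere μ hInt]
  have hpos : 0 < Module.finrank ℝ E := Module.finrank_pos
  have hpow : ∫ r in (0 : ℝ)..1, r ^ (Module.finrank ℝ E - 1) = (Module.finrank ℝ E : ℝ)⁻¹ := by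
    rw [integral_pow, Nat.sub_add_cancel hpos, Nat.cast_pred hpos]
    simp [hpos.ne']
  rw [← hpow, ← intervalIntegral.integral_smul_const]
  refine intervalIntegral.integral_congr_ae (.of_forall fun r hr => ?_)
  rw [uIoc_of_le zero_le_one] at hr
  have hθ : ∀ θ : sphere (0 : E) 1, ‖r • (θ : E)‖⁻¹ • r • (θ : E) = θ := fun θ => by
    rw [norm_smul, norm_eq_of_mem_sphere, mul_one, Real.norm_eq_abs, abs_of_pos hr.1,
      inv_smul_smul₀ hr.1.ne']
  simp only [hθ]

end Polar

section Smoothing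

variable {E : Type*} [NormedAddCommGroup E]

/-- A radial cutoff, equal to `1` on the unit ball and supported in the ball of radius `1 + ε`. -/
noncomputable def radialCutoff (ε : ℝ) (t : E) : ℝ :=
  Real.smoothTransition (1 + (1 - ‖t‖) / ε)

theorem radialCutoff_eventuallyEq_one {ε : ℝ} (hε : 0 < ε) :
    radialCutoff ε =ᶠ[𝓝 (0 : E)] fun _ => 1 := by
  filter_upwards [ball_mem_nhds (0 : E) one_pos] with t ht
  have : ‖t‖ < 1 := by simpa using ht
  exact Real.smoothTransition.one_of_one_le
    (le_add_of_nonneg_right (div_nonneg (by linarith) hε.le))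

variable [InnerProductSpace ℝ E]

theorem hasFDerivAt_norm_of_ne_zero {t : E} (ht : t ≠ 0) :
    HasFDerivAt (fun t : E => ‖t‖) (‖t‖⁻¹ • innerSL ℝ t) t := by
  have h := (hasStrictFDerivAt_norm_sq t).hasFDerivAt.sqrt (by simpa using ht)
  simp only [Real.sqrt_sq (norm_nonneg _)] at h
  convert! h using 1
  rw [← Nat.cast_smul_eq_nsmul ℝ, smul_smul]
  congr 1
  field_simp
  simp

theorem contDiff_radialCutoff {ε : ℝ} (hε : 0 < ε) :
    ContDiff ℝ 1 (radialCutoff ε : E → ℝ) := by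
  rw [contDiff_iff_contDiffAt]
  intro t
  by_cases ht : t = 0
  · subst ht
    exact contDiffAt_const.congr_of_eventuallyEq (radialCutoff_eventuallyEq_one hε)
  · have hn : ContDiffAt ℝ 1 (fun t : E => ‖t‖) t := contDiffAt_norm ℝ ht
    exact (Real.smoothTransition.contDiffAt (n := 1)).comp t
      (contDiffAt_const.add ((contDiffAt_const.sub hn).div_const ε))

theorem fderiv_radialCutoff (ε : ℝ) {t : E} (ht : t ≠ 0) :
    fderiv ℝ (radialCutoff ε) t =
      -(ε⁻¹ * deriv Real.smoothTransition (1 + (1 - ‖t‖) / ε)) • (‖t‖⁻¹ • innerSL ℝ t) := by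
  have h1 := (((hasFDerivAt_norm_of_ne_zero ht).const_sub 1).mul_const ε⁻¹).const_add 1
  have h2 : HasDerivAt Real.smoothTransition _ (1 + (1 - ‖t‖) * ε⁻¹) :=
    ((Real.smoothTransition.contDiffAt (n := 1)).differentiableAt one_ne_zero).hasDerivAt
  have h3 := (h2.comp_hasFDerivAt t h1).fderiv
  simp only [div_eq_mul_inv]
  refine Eq.trans h3 ?_
  module

theorem hasCompactSupport_radialCutoff [FiniteDimensional ℝ E] {ε : ℝ} (hε : 0 < ε) :
    HasCompactSupport (radialCutoff ε : E → ℝ) := by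
  refine HasCompactSupport.intro (isCompact_closedBall (0 : E) (1 + ε)) fun t ht => ?_
  have : 1 + ε < ‖t‖ := by simpa using ht
  refine Real.smoothTransition.zero_of_nonpos ?_
  have : (1 - ‖t‖) / ε ≤ -1 := by rw [div_le_iff₀ hε]; linarith
  linarith

variable [FiniteDimensional ℝ E] [MeasurableSpace E] [BorelSpace E] [Nontrivial E]

theorem integral_radialCutoff_mul (μ : Measure E) [μ.IsAddHaarMeasure] {f : E → ℝ}
    (hf : Continuous f) {ε : ℝ} (hε : 0 < ε) :
    ∫ t, radialCutoff ε t * f t ∂μ = (∫ t in closedBall 0 1, f t ∂μ) +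
      ε * ∫ s in (0 : ℝ)..1, Real.smoothTransition s *
        ((1 + ε * (1 - s)) ^ (Module.finrank ℝ E - 1) *
          ∫ θ, f ((1 + ε * (1 - s)) • (θ : E)) ∂μ.toSphere) := by
  have hInt : Integrable (fun t => radialCutoff ε t * f t) μ :=
    ((contDiff_radialCutoff hε).continuous.mul hf).integrable_of_hasCompactSupport
      (hasCompactSupport_radialCutoff hε).mul_right
  have hM : Continuous fun r : ℝ => ∫ θ, f (r • (θ : E)) ∂μ.toSphere :=
    continuous_integral_sphere μ (by fun_prop)
  have key := integral_Ioi_profile_smul Real.smoothTransition.continuous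
    (fun s => Real.smoothTransition.zero_of_nonpos)
    (a := fun r => r ^ (Module.finrank ℝ E - 1) • ∫ θ, f (r • (θ : E)) ∂μ.toSphere)
    (by fun_prop) hε
  rw [integral_eq_integral_Ioi_integral_sphere μ hInt,
    setIntegral_closedBall_eq_integral_sphere μ
      (hf.continuousOn.integrableOn_compact (isCompact_closedBall _ _))]
  simp only [smul_eq_mul] at key ⊢
  rw [← intervalIntegral.integral_congr (μ := volume) (a := 0) (b := 1) (f := fun r =>
    Real.smoothTransition (1 + (1 - r) / ε) *
      (r ^ (Module.finrank ℝ E - 1) * ∫ θ, f (r • (θ : E)) ∂μ.toSphere)), ← key]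
  · refine setIntegral_congr_fun measurableSet_Ioi fun r hr => ?_
    have hr : 0 < r := hr
    simp only [radialCutoff, norm_smul, norm_eq_of_mem_sphere, Real.norm_eq_abs, abs_of_pos hr,
      mul_one, integral_const_mul]
    ring
  · intro r hr
    rw [uIcc_of_le zero_le_one] at hr
    simp only
    rw [Real.smoothTransition.one_of_one_le, one_mul]
    exact le_add_of_nonneg_right (div_nonneg (by linarith [hr.2]) hε.le)

theorem integral_smul_fderiv_radialCutoff (μ : Measure E) [μ.IsAddHaarMeasure] {f : E → ℝ}
    (hf : Continuous f) {ε : ℝ} (hε : 0 < ε) :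
    ∫ t, f t • fderiv ℝ (radialCutoff ε) t ∂μ =
      -∫ s in (0 : ℝ)..1, deriv Real.smoothTransition s •
        ((1 + ε * (1 - s)) ^ (Module.finrank ℝ E - 1) •
          ∫ θ, f ((1 + ε * (1 - s)) • (θ : E)) • innerSL ℝ (θ : E) ∂μ.toSphere) := by
  have hInt : Integrable (fun t => f t • fderiv ℝ (radialCutoff ε) t) μ :=
    (hf.smul ((contDiff_radialCutoff hε).continuous_fderiv one_ne_zero)
      ).integrable_of_hasCompactSupport
      ((hasCompactSupport_radialCutoff hε).fderiv ℝ).smul_left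
  have hM : Continuous fun r : ℝ =>
      ∫ θ, f (r • (θ : E)) • innerSL ℝ (θ : E) ∂μ.toSphere :=
    continuous_integral_sphere μ (by fun_prop)
  have key := integral_Ioi_profile_smul continuous_deriv_smoothTransition
    (fun s => deriv_smoothTransition_of_nonpos)
    (a := fun r => r ^ (Module.finrank ℝ E - 1) •
      ∫ θ, f (r • (θ : E)) • innerSL ℝ (θ : E) ∂μ.toSphere)
    (by fun_prop) hε
  have hzero : ∫ r in (0 : ℝ)..1, deriv Real.smoothTransition (1 + (1 - r) / ε) •
      r ^ (Module.finrank ℝ E - 1) •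
        ∫ θ, f (r • (θ : E)) • innerSL ℝ (θ : E) ∂μ.toSphere = 0 := by
    refine intervalIntegral.integral_zero_ae (.of_forall fun r hr => ?_)
    rw [uIoc_of_le zero_le_one] at hr
    rw [deriv_smoothTransition_of_one_le, zero_smul]
    exact le_add_of_nonneg_right (div_nonneg (by linarith [hr.2]) hε.le)
  rw [hzero, zero_add] at key
  rw [integral_eq_integral_Ioi_integral_sphere μ hInt,
    ← inv_smul_smul₀ hε.ne' (intervalIntegral _ _ _ _),
    ← key, ← integral_smul, ← integral_neg]
  refine setIntegral_congr_fun measurableSet_Ioi fun r hr => ?_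
  have hr : 0 < r := hr
  have hθ : ∀ θ : sphere (0 : E) 1, f (r • (θ : E)) • fderiv ℝ (radialCutoff ε) (r • (θ : E)) =
      -(ε⁻¹ * deriv Real.smoothTransition (1 + (1 - r) / ε)) •
        (f (r • (θ : E)) • innerSL ℝ (θ : E)) := by
    intro θ
    have hn : ‖r • (θ : E)‖ = r := by simp [norm_smul, abs_of_pos hr]
    have h0 : r • (θ : E) ≠ 0 := norm_ne_zero_iff.1 (by rw [hn]; exact hr.ne')
    rw [fderiv_radialCutoff ε h0, hn, map_smul (innerSL ℝ), inv_smul_smul₀ hr.ne', smul_comm]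
  simp only [hθ, integral_smul]
  module

/-- The gradient of the integral over a moving ball is an integral over its boundary sphere. -/
theorem hasFDerivAt_setIntegral_closedBall_sub (μ : Measure E) [μ.IsAddHaarMeasure]
    {g : E → ℝ} (hg : Continuous g) (x : E) :
    HasFDerivAt (fun x => ∫ t in closedBall 0 1, g (x - t) ∂μ)
      (-∫ θ, g (x - (θ : E)) • innerSL ℝ (θ : E) ∂μ.toSphere) x := by
  let ε : ℕ → ℝ := fun k => 1 / ((k : ℝ) + 1)
  have hε : ∀ k, 0 < ε k := fun k => Nat.one_div_pos_of_nat
  have hε0 : Tendsto ε atTop (𝓝 0) := tendsto_one_div_add_atTop_nhds_zero_nat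
  let A : ℝ → E → ℝ := fun e x => ∫ s in (0 : ℝ)..1, Real.smoothTransition s *
        ((1 + e * (1 - s)) ^ (Module.finrank ℝ E - 1) *
          ∫ θ, g (x - (1 + e * (1 - s)) • (θ : E)) ∂μ.toSphere)
  let B : ℝ × E → E →L[ℝ] ℝ := fun p => -∫ s in (0 : ℝ)..1, deriv Real.smoothTransition s •
        ((1 + p.1 * (1 - s)) ^ (Module.finrank ℝ E - 1) •
          ∫ θ, g (p.2 - (1 + p.1 * (1 - s)) • (θ : E)) • innerSL ℝ (θ : E) ∂μ.toSphere)
  have hA : ∀ x, Continuous fun e => A e x := fun x => by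
    have hM : Continuous fun r : ℝ => ∫ θ, g (x - r • (θ : E)) ∂μ.toSphere :=
      continuous_integral_sphere μ (by fun_prop)
    have hM' : Continuous fun q : ℝ × ℝ =>
        ∫ θ, g (x - (1 + q.1 * (1 - q.2)) • (θ : E)) ∂μ.toSphere :=
      hM.comp (f := fun q : ℝ × ℝ => 1 + q.1 * (1 - q.2)) (by fun_prop)
    have hs := Real.smoothTransition.continuous
    exact intervalIntegral.continuous_parametric_intervalIntegral_of_continuous'
      (by simp only [Function.uncurry_def]; fun_prop) _ _
  have hB : Continuous B := by
    have hM : Continuous fun q : E × ℝ =>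
        ∫ θ, g (q.1 - q.2 • (θ : E)) • innerSL ℝ (θ : E) ∂μ.toSphere :=
      continuous_integral_sphere μ (by fun_prop)
    have hs := continuous_deriv_smoothTransition
    refine (intervalIntegral.continuous_parametric_intervalIntegral_of_continuous'
      (f := fun (p : ℝ × E) s => deriv Real.smoothTransition s •
        ((1 + p.1 * (1 - s)) ^ (Module.finrank ℝ E - 1) •
          ∫ θ, g (p.2 - (1 + p.1 * (1 - s)) • (θ : E)) • innerSL ℝ (θ : E) ∂μ.toSphere))
      ?_ _ _).neg
    have hM' : Continuous fun q : (ℝ × E) × ℝ =>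
        ∫ θ, g (q.1.2 - (1 + q.1.1 * (1 - q.2)) • (θ : E)) • innerSL ℝ (θ : E) ∂μ.toSphere :=
      hM.comp (g := fun q : E × ℝ => _)
        (f := fun q : (ℝ × E) × ℝ => (q.1.2, 1 + q.1.1 * (1 - q.2))) (by fun_prop)
    simp only [Function.uncurry_def]
    fun_prop
  have hB0 : ∀ x, B (0, x) = -∫ θ, g (x - (θ : E)) • innerSL ℝ (θ : E) ∂μ.toSphere := by
    intro x
    simp [B, intervalIntegral.integral_smul_const, integral_deriv_smoothTransition]
  rw [← hB0]
  have hK : ∀ k x, HasFDerivAt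
      (fun x => (∫ t in closedBall 0 1, g (x - t) ∂μ) + ε k * A (ε k) x) (B (ε k, x)) x := by
    intro k x
    have h := (hasCompactSupport_radialCutoff (E := E) (hε k)).hasFDerivAt_convolution_left
      (μ := μ) (ContinuousLinearMap.mul ℝ ℝ) (contDiff_radialCutoff (hε k))
      hg.locallyIntegrable x
    convert! h using 1
    · funext y
      exact (integral_radialCutoff_mul μ (f := fun t => g (y - t)) (by fun_prop) (hε k)).symm
    · refine (integral_smul_fderiv_radialCutoff μ (f := fun t => g (x - t)) (by fun_prop)
        (hε k)).symm.trans ?_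
      refine integral_congr_ae (.of_forall fun t => ?_)
      ext v
      simp [mul_comm]
  refine hasFDerivAt_of_tendstoLocallyUniformlyOn (l := atTop) (s := univ)
    (g' := fun x => B (0, x)) isOpen_univ ?_ (fun k x _ => hK k x) (fun x _ => ?_) (mem_univ x)
  · rw [tendstoLocallyUniformlyOn_univ, tendstoLocallyUniformly_iff_forall_tendsto]
    intro x
    have h1 : Tendsto (fun y : ℕ × E => (ε y.1, y.2)) (atTop ×ˢ 𝓝 x) (𝓝 (0, x)) :=
      (hε0.comp tendsto_fst).prodMk_nhds tendsto_snd
    have h2 : Tendsto (fun y : ℕ × E => ((0 : ℝ), y.2)) (atTop ×ˢ 𝓝 x) (𝓝 (0, x)) :=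
      tendsto_const_nhds.prodMk_nhds tendsto_snd
    have := ((hB.tendsto _).comp h2).prodMk_nhds ((hB.tendsto _).comp h1)
    exact this.mono_right (nhds_le_uniformity _)
  · have := (hε0.mul (((hA x).tendsto 0).comp hε0)).const_add (∫ t in closedBall 0 1, g (x - t) ∂μ)
    simpa using this

theorem integral_ballUniform {F : Type*} [NormedAddCommGroup F] [NormedSpace ℝ F] (n : ℕ)
    (f : EuclideanSpace ℝ (Fin n) → F) :
    ∫ u, f u ∂(ballUniform n) =
      (volume (closedBall (0 : EuclideanSpace ℝ (Fin n)) 1))⁻¹.toReal •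
        ∫ u in closedBall 0 1, f u :=
  integral_smul_measure _ _

theorem integral_sphereUniform_inv_norm_smul (n : ℕ) [NeZero n] {η : ℝ} (hη : 0 < η)
    {f : EuclideanSpace ℝ (Fin n) → ℝ} (hf : Continuous f) :
    ∫ v, (f v * ‖v‖⁻¹) • v ∂(sphereUniform n η) =
      (volume (closedBall (0 : EuclideanSpace ℝ (Fin n)) 1))⁻¹.toReal • (n : ℝ)⁻¹ •
        ∫ θ, f (η • (θ : EuclideanSpace ℝ (Fin n))) • (θ : EuclideanSpace ℝ (Fin n))
          ∂(volume : Measure (EuclideanSpace ℝ (Fin n))).toSphere := by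
  have hmeas : Measurable fun v : EuclideanSpace ℝ (Fin n) => (f v * ‖v‖⁻¹) • v :=
    (hf.measurable.mul measurable_norm.inv).smul measurable_id
  rw [sphereUniform, integral_map (by fun_prop) hmeas.aestronglyMeasurable, integral_ballUniform]
  have key := setIntegral_closedBall_inv_norm_smul
    (volume : Measure (EuclideanSpace ℝ (Fin n))) (f := fun v => f (η • v) • v) (by fun_prop)
  rw [finrank_euclideanSpace_fin] at key
  rw [← key]
  congr 2 with u : 1
  rcases eq_or_ne u 0 with rfl | hu
  · simp
  have hu' : ‖u‖ ≠ 0 := norm_ne_zero_iff.2 hu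
  have hn : ‖(η / ‖u‖) • u‖ = η := by
    rw [norm_smul, norm_div, norm_norm, div_mul_cancel₀ _ hu', Real.norm_of_nonneg hη.le]
  rw [hn, smul_smul, smul_smul, smul_smul, div_eq_mul_inv]
  congr 1
  field_simp

theorem hasFDerivAt_smoothed (n : ℕ) [NeZero n] {η : ℝ} (hη : 0 < η)
    {h : EuclideanSpace ℝ (Fin n) → ℝ} (hcont : Continuous h) (x : EuclideanSpace ℝ (Fin n)) :
    HasFDerivAt (smoothed n η h)
      (((volume (closedBall (0 : EuclideanSpace ℝ (Fin n)) 1))⁻¹.toReal * η⁻¹) •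
        ∫ θ, h (x + η • (θ : EuclideanSpace ℝ (Fin n))) • innerSL ℝ
          (θ : EuclideanSpace ℝ (Fin n))
          ∂(volume : Measure (EuclideanSpace ℝ (Fin n))).toSphere) x := by
  have hg : ∀ x t : EuclideanSpace ℝ (Fin n), h (-(η • ((-η⁻¹) • x - t))) = h (x + η • t) := by
    intro x t
    congr 1
    rw [smul_sub, smul_smul, mul_neg, mul_inv_cancel₀ hη.ne']
    module
  have hlin : HasFDerivAt (fun x : EuclideanSpace ℝ (Fin n) => (-η⁻¹) • x)
      ((-η⁻¹) • ContinuousLinearMap.id ℝ (EuclideanSpace ℝ (Fin n))) x :=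
    (hasFDerivAt_id x).const_smul (-η⁻¹)
  have hd := ((hasFDerivAt_setIntegral_closedBall_sub volume
    (g := fun y => h (-(η • y))) (by fun_prop) ((-η⁻¹) • x)).comp x hlin).const_smul
      (volume (closedBall (0 : EuclideanSpace ℝ (Fin n)) 1))⁻¹.toReal
  convert! hd using 1
  · funext y
    simp only [smoothed, integral_ballUniform, Pi.smul_apply, Function.comp_apply, hg]
  · simp only [hg]
    rw [ContinuousLinearMap.comp_smul, ContinuousLinearMap.comp_id]
    module

theorem hasGradientAt_smoothed (n : ℕ) [NeZero n] {η : ℝ} (hη : 0 < η)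
    {h : EuclideanSpace ℝ (Fin n) → ℝ} (hcont : Continuous h) (x : EuclideanSpace ℝ (Fin n)) :
    HasGradientAt (smoothed n η h)
      (((n : ℝ) / η) • ∫ v, (h (x + v) * ‖v‖⁻¹) • v ∂(sphereUniform n η)) x := by
  rw [hasGradientAt_iff_hasFDerivAt]
  convert! hasFDerivAt_smoothed n hη hcont x using 1
  rw [integral_sphereUniform_inv_norm_smul n hη (f := fun v => h (x + v)) (by fun_prop),
    map_smul, map_smul, map_smul, smul_smul, smul_smul]
  have hn : (n : ℝ) ≠ 0 := NeZero.ne _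
  congr 1
  · field_simp
  · refine ((InnerProductSpace.toDual ℝ (EuclideanSpace ℝ (Fin n))).toContinuousLinearEquiv
      |>.integral_comp_comm _).symm.trans ?_
    refine integral_congr_ae (.of_forall fun θ => ?_)
    ext v
    simp

end Smoothing

theorem smoothed_contDiff_and_gradient (n : ℕ) (η : ℝ) (hη : 0 < η)
    (h : EuclideanSpace ℝ (Fin n) → ℝ) (hcont : Continuous h) :
    ContDiff ℝ 1 (smoothed n η h) ∧
    ∀ x, gradient (smoothed n η h) x =
      ((n : ℝ) / η) • ∫ v, (h (x + v) * ‖v‖⁻¹) • v ∂(sphereUniform n η) := by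
  rcases eq_or_ne n 0 with rfl | hn
  · have : smoothed 0 η h = fun _ => smoothed 0 η h 0 :=
      funext fun x => congrArg _ (Subsingleton.elim _ _)
    exact ⟨this ▸ contDiff_const, fun x => Subsingleton.elim _ _⟩
  have : NeZero n := ⟨hn⟩
  refine ⟨?_, fun x => (hasGradientAt_smoothed n hη hcont x).gradient⟩
  refine contDiff_one_iff_hasFDerivAt.2 ⟨_, ?_, hasFDerivAt_smoothed n hη hcont⟩
  have := continuous_integral_sphere (volume : Measure (EuclideanSpace ℝ (Fin n)))
    (f := fun x θ => h (x + η • θ.1) • innerSL ℝ θ.1) (by fun_prop)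
  exact this.const_smul
    ((volume (closedBall (0 : EuclideanSpace ℝ (Fin n)) 1))⁻¹.toReal * η⁻¹)
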